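/- arXiv:1203.5364 — 4 statements merged into one kernel-verified Lean document; each statement's English description precedes it below -/
import Mathlib

section
/- For every bipartition (μ,ν) of n, in the sequence (2μ_1, 2ν_1, 2μ_2, 2ν_2, …) the adjacent pairs (2s,2t) with s < t are pairwise disjoint (no term belongs to two such pairs), so the replacement rule defining Φ^C is well-defined; the resulting sequence is weakly decreasing, hence a partition of 2n; and every odd part of Φ^C(μ,ν) occurs with even multiplicity, i.e. Φ^C(μ,ν) ∈ 𝒫_{2n}^C. -/
noncomputable section

/-- A partition, encoded as a weakly decreasing function `ℕ → ℕ` (0-indexed parts)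
with finitely many nonzero values. -/
def IsPartitionFun (μ : ℕ → ℕ) : Prop :=
  (∀ i j : ℕ, i ≤ j → μ j ≤ μ i) ∧ ∃ N : ℕ, ∀ i : ℕ, N ≤ i → μ i = 0

/-- The size `|μ|` of a partition. -/
def psum (μ : ℕ → ℕ) : ℕ := ∑ᶠ i, μ i

/-- The interleaved sequence `(2μ₁, 2ν₁, 2μ₂, 2ν₂, …)` (0-indexed). -/
def interleave (μ ν : ℕ → ℕ) : ℕ → ℕ :=
  fun k => if k % 2 = 0 then 2 * μ (k / 2) else 2 * ν (k / 2)

/-- `Φ^C(μ,ν)`: in the sequence `(2μ₁, 2ν₁, 2μ₂, 2ν₂, …)`, each adjacent pair `(2s, 2t)`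
with `s < t` is replaced by `(s+t, s+t)`. -/
def PhiC (μ ν : ℕ → ℕ) : ℕ → ℕ := fun k =>
  let c := interleave μ ν
  if c k < c (k + 1) then (c k + c (k + 1)) / 2
  else if 0 < k ∧ c (k - 1) < c k then (c (k - 1) + c k) / 2
  else c k

/-- Replace every ascending adjacent pair of a sequence by twice its mean. -/
def mergeAscents (c : ℕ → ℕ) : ℕ → ℕ := fun k =>
  if c k < c (k + 1) then (c k + c (k + 1)) / 2
  else if 0 < k ∧ c (k - 1) < c k then (c (k - 1) + c k) / 2
  else c k

lemma PhiC_eq_mergeAscents (μ ν : ℕ → ℕ) : PhiC μ ν = mergeAscents (interleave μ ν) := rfl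

lemma interleave_even (μ ν : ℕ → ℕ) (k : ℕ) : interleave μ ν k % 2 = 0 := by
  unfold interleave
  split_ifs <;> omega

lemma interleave_add_two_le {μ ν : ℕ → ℕ} (hμ : ∀ i j : ℕ, i ≤ j → μ j ≤ μ i)
    (hν : ∀ i j : ℕ, i ≤ j → ν j ≤ ν i) (k : ℕ) :
    interleave μ ν (k + 2) ≤ interleave μ ν k := by
  have h1 := hμ (k / 2) (k / 2 + 1) (by omega)
  have h2 := hν (k / 2) (k / 2 + 1) (by omega)
  have h3 : (k + 2) / 2 = k / 2 + 1 := by omega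
  have h4 : (k + 2) % 2 = k % 2 := by omega
  unfold interleave
  rw [h3, h4]
  split_ifs <;> omega

lemma sum_range_interleave (μ ν : ℕ → ℕ) (M : ℕ) :
    ∑ k ∈ Finset.range (2 * M), interleave μ ν k =
      2 * (∑ i ∈ Finset.range M, μ i + ∑ i ∈ Finset.range M, ν i) := by
  induction M with
  | zero => simp
  | succ M ih =>
    have h1 : interleave μ ν (2 * M) = 2 * μ M := by simp [interleave]
    have h2 : interleave μ ν (2 * M + 1) = 2 * ν M := by
      have h3 : (2 * M + 1) / 2 = M := by omega
      have h4 : (2 * M + 1) % 2 = 1 := by omega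
      simp [interleave, h3, h4]
    rw [show 2 * (M + 1) = 2 * M + 1 + 1 by ring, Finset.sum_range_succ, Finset.sum_range_succ,
      ih, h1, h2, Finset.sum_range_succ, Finset.sum_range_succ]
    ring

lemma psum_eq_sum_range {μ : ℕ → ℕ} {N : ℕ} (h : ∀ i : ℕ, N ≤ i → μ i = 0) :
    psum μ = ∑ i ∈ Finset.range N, μ i := by
  refine finsum_eq_sum_of_support_subset μ fun i hi => ?_
  by_contra hN
  exact hi (h i (by simpa using hN))

section MergeAscents

variable {c : ℕ → ℕ}

lemma mergeAscents_succ (c : ℕ → ℕ) (k : ℕ) :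
    mergeAscents c (k + 1) =
      if c (k + 1) < c (k + 2) then (c (k + 1) + c (k + 2)) / 2
      else if c k < c (k + 1) then (c k + c (k + 1)) / 2
      else c (k + 1) := by
  simp [mergeAscents]

lemma mergeAscents_succ_le (hc : ∀ k, c (k + 2) ≤ c k) (k : ℕ) :
    mergeAscents c (k + 1) ≤ mergeAscents c k := by
  have h1 := hc k
  have h2 := hc (k + 1)
  rw [mergeAscents_succ]
  rcases k with _ | j
  · simp only [mergeAscents, Nat.zero_add, Nat.reduceAdd] at *
    split_ifs <;> omega
  · have h3 := hc j
    rw [mergeAscents_succ]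
    simp only [add_assoc, Nat.reduceAdd] at *
    split_ifs <;> omega

lemma mergeAscents_eq_zero {N : ℕ} (hN : ∀ k, N ≤ k → c k = 0) {k : ℕ} (hk : N ≤ k) :
    mergeAscents c (k + 1) = 0 := by
  simp [mergeAscents, hN k hk, hN (k + 1) (by omega), hN (k + 1 + 1) (by omega)]

lemma sum_range_mergeAscents (hc : ∀ k, c (k + 2) ≤ c k) (he : ∀ k, c k % 2 = 0) (k : ℕ) :
    ∑ i ∈ Finset.range (k + 1), mergeAscents c i =
      ∑ i ∈ Finset.range (k + 1), c i + (c (k + 1) - c k) / 2 := by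
  induction k with
  | zero =>
    have h0 := he 0
    have h1 := he 1
    simp only [Nat.zero_add, Finset.sum_range_one, mergeAscents]
    split_ifs <;> omega
  | succ k ih =>
    have h0 := he k
    have h1 := he (k + 1)
    have h2 := he (k + 1 + 1)
    have h3 := hc k
    rw [Finset.sum_range_succ, ih, Finset.sum_range_succ _ (k + 1)]
    simp only [mergeAscents, Nat.add_sub_cancel, add_assoc, Nat.reduceAdd] at *
    split_ifs <;> omega

lemma even_ncard_mergeAscents_eq (hc : ∀ k, c (k + 2) ≤ c k) (he : ∀ k, c k % 2 = 0) {N : ℕ}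
    (hN : ∀ k, N ≤ k → c k = 0) {m : ℕ} (hm : Odd m) :
    Even {k : ℕ | mergeAscents c k = m}.ncard := by
  set A : Set ℕ := {k | c k < c (k + 1) ∧ (c k + c (k + 1)) / 2 = m} with hA
  have hAfin : A.Finite := by
    refine (Set.finite_Iio N).subset fun k hk => ?_
    by_contra hNk
    have h1 := hN (k + 1) (by simp at hNk; omega)
    have h2 := hk.1
    omega
  have hunion : {k : ℕ | mergeAscents c k = m} = A ∪ Nat.succ '' A := by
    ext k
    have hmod := Nat.odd_iff.mp hm
    have h0 := he k
    rcases k with _ | j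
    · simp only [mergeAscents, hA, Set.mem_ofPred_eq, Set.mem_union, Set.mem_image]
      simp only [Nat.succ_ne_zero, and_false, exists_false, or_false]
      split_ifs <;> omega
    · have hj : j + 1 ∈ Nat.succ '' A ↔ j ∈ A := Nat.succ_injective.mem_set_image
      have h3 := hc j
      rw [Set.mem_union, hj]
      simp only [mergeAscents, hA, Set.mem_ofPred_eq, Nat.add_sub_cancel, add_assoc,
        Nat.reduceAdd] at *
      split_ifs <;> omega
  have hdisj : Disjoint A (Nat.succ '' A) := by
    rw [Set.disjoint_left]
    rintro _ h ⟨j, hj, rfl⟩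
    have h1 := h.1
    have h2 := hj.1
    have h3 := hc j
    simp only [Nat.succ_eq_add_one, add_assoc, Nat.reduceAdd] at *
    omega
  rw [hunion, Set.ncard_union_eq hdisj hAfin (hAfin.image _),
    Set.ncard_image_of_injective _ Nat.succ_injective]
  exact ⟨_, rfl⟩

end MergeAscents

/-- for a bipartition `(μ,ν)` of `n`, the inverted adjacent pairs in the
sequence `(2μ₁, 2ν₁, 2μ₂, 2ν₂, …)` are pairwise disjoint (so `Φ^C` is well-defined), the
resulting sequence `Φ^C(μ,ν)` is weakly decreasing, is a partition of `2n`, and every odd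
part of it occurs with even multiplicity, i.e. `Φ^C(μ,ν) ∈ 𝒫_{2n}^C`. -/
theorem PhiC_well_defined (n : ℕ) (hn : 1 ≤ n) (μ ν : ℕ → ℕ)
    (hμ : IsPartitionFun μ) (hν : IsPartitionFun ν) (hsum : psum μ + psum ν = n) :
    (∀ k : ℕ, ¬(interleave μ ν k < interleave μ ν (k + 1) ∧
        interleave μ ν (k + 1) < interleave μ ν (k + 2))) ∧
    IsPartitionFun (PhiC μ ν) ∧
    psum (PhiC μ ν) = 2 * n ∧
    (∀ m : ℕ, Odd m → Even {k : ℕ | PhiC μ ν k = m}.ncard) := by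
  obtain ⟨hμ, N₁, hN₁⟩ := hμ
  obtain ⟨hν, N₂, hN₂⟩ := hν
  have hc := interleave_add_two_le hμ hν
  have he := interleave_even μ ν
  obtain ⟨M, hM₁, hM₂⟩ : ∃ M, N₁ ≤ M ∧ N₂ ≤ M := ⟨max N₁ N₂, by simp, by simp⟩
  have hN : ∀ k, 2 * M ≤ k → interleave μ ν k = 0 := by
    intro k hk
    simp [interleave, hN₁ (k / 2) (by omega), hN₂ (k / 2) (by omega)]
  have hzero : ∀ k, 2 * M + 1 ≤ k → mergeAscents (interleave μ ν) k = 0 := by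
    rintro (_ | k) hk
    · omega
    · exact mergeAscents_eq_zero hN (by omega)
  rw [PhiC_eq_mergeAscents]
  refine ⟨fun k h => ?_, ⟨fun i j hij => ?_, 2 * M + 1, hzero⟩, ?_, fun m hm => ?_⟩
  · exact absurd (hc k) (not_le.mpr (h.1.trans h.2))
  · exact antitone_nat_of_succ_le (mergeAscents_succ_le hc) hij
  · rw [psum_eq_sum_range hzero, sum_range_mergeAscents hc he, Finset.sum_range_succ,
      sum_range_interleave, hN (2 * M) le_rfl, hN (2 * M + 1) (by omega), ← hsum,
      psum_eq_sum_range fun i hi => hN₁ i (hM₁.trans hi),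
      psum_eq_sum_range fun i hi => hN₂ i (hM₂.trans hi)]
    simp
  · exact even_ncard_mergeAscents_eq hc he hN hm

end
end

section
/- For every μ ∈ ℤ^n, the type-C Kostant partition functions satisfy p'(μ) = Σ_{S ⊆ {1,…,n}} p(μ − Σ_{i∈S} ε_i), where the sum runs over all subsets S of {1,…,n}. -/
noncomputable section

/-- The standard basis vector `ε_i` of `ℤ^n`. -/
def eps (n : ℕ) (i : Fin n) : Fin n → ℤ := Pi.single i 1

/-- The set of positive roots of type `C_n`:
`{ε_i − ε_j, ε_i + ε_j : i < j} ∪ {2ε_i}`. -/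
def DeltaC (n : ℕ) : Set (Fin n → ℤ) :=
  {α | (∃ i j : Fin n, i < j ∧ (α = eps n i - eps n j ∨ α = eps n i + eps n j)) ∨
    ∃ i : Fin n, α = 2 • eps n i}

/-- The modified root system `Δ' = {ε_i − ε_j, ε_i + ε_j : i < j} ∪ {ε_i}`. -/
def DeltaC' (n : ℕ) : Set (Fin n → ℤ) :=
  {α | (∃ i j : Fin n, i < j ∧ (α = eps n i - eps n j ∨ α = eps n i + eps n j)) ∨
    ∃ i : Fin n, α = eps n i}

/-- The Kostant partition function attached to a set `Δ` of vectors: the number of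
functions `f : Δ → ℕ` with `Σ_{α ∈ Δ} f(α)·α = μ` (encoded as finitely supported
functions on `Fin n → ℤ` whose support lies in `Δ`). -/
def kostant (n : ℕ) (Δ : Set (Fin n → ℤ)) (μ : Fin n → ℤ) : ℕ :=
  Nat.card {f : (Fin n → ℤ) →₀ ℕ //
    ↑f.support ⊆ Δ ∧ (f.sum fun α c => c • α) = μ}

/-- Only finitely many `ℕ`-combinations of a finite set `A` sum to `μ`, provided some additive
functional is at least `1` on `A`. -/
theorem finite_partitions_of_height {M : Type*} [AddCommGroup M] {A : Set M} (hA : A.Finite)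
    (h : M →+ ℤ) (hpos : ∀ α ∈ A, 1 ≤ h α) (μ : M) :
    Finite {f : M →₀ ℕ // ↑f.support ⊆ A ∧ (f.sum fun α c => c • α) = μ} := by
  have bound : ∀ f : M →₀ ℕ, ↑f.support ⊆ A → (f.sum fun α c => c • α) = μ →
      ∀ α, f α < (h μ).toNat + 1 := by
    intro f hf hs α
    by_cases hα : α ∈ f.support
    · have hsum : h μ = ∑ β ∈ f.support, (f β : ℤ) * h β := by
        rw [← hs, Finsupp.sum, map_sum]
        simp
      have hterm : (f α : ℤ) * h α ≤ ∑ β ∈ f.support, (f β : ℤ) * h β :=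
        Finset.single_le_sum (f := fun β => (f β : ℤ) * h β)
          (fun β hβ => mul_nonneg (Nat.cast_nonneg _) (by linarith [hpos β (hf hβ)])) hα
      have hle : (f α : ℤ) ≤ (f α : ℤ) * h α :=
        le_mul_of_one_le_right (Nat.cast_nonneg _) (hpos α (hf hα))
      lia
    · rw [Finsupp.notMem_support_iff.mp hα]
      lia
  have := hA.to_subtype
  refine Finite.of_injective
    (fun f (α : A) => (⟨f.1 α, bound f.1 f.2.1 f.2.2 α⟩ : Fin ((h μ).toNat + 1))) ?_
  rintro ⟨f, hf, hfs⟩ ⟨g, hg, hgs⟩ hfg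
  refine Subtype.ext (Finsupp.ext fun α => ?_)
  by_cases hα : α ∈ A
  · simpa using congrFun hfg ⟨α, hα⟩
  · rw [Finsupp.notMem_support_iff.mp fun hm => hα (hf hm),
      Finsupp.notMem_support_iff.mp fun hm => hα (hg hm)]

theorem sum_add_mapDomain_smul {M ι : Type*} [AddCommGroup M] [Fintype ι] (v : ι → M)
    (g : M →₀ ℕ) (c : ι → ℕ) :
    ((g + (Finsupp.equivFunOnFinite.symm c).mapDomain v).sum fun α k => k • α) =
      (g.sum fun α k => k • α) + ∑ i, c i • v i := by
  rw [Finsupp.sum_add_index' (by simp) (by simp [add_smul]),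
    Finsupp.sum_mapDomain_index (by simp) (by simp [add_smul]),
    Finsupp.sum_fintype (Finsupp.equivFunOnFinite.symm c) _ (by simp)]
  simp

theorem filter_add_mapDomain_eq {M ι : Type*} [Fintype ι] {A : Set M}
    [DecidablePred (· ∈ A)] {v : ι → M} (hv : Function.Injective v) (hd : ∀ i, v i ∉ A)
    (f : M →₀ ℕ) (hf : ↑f.support ⊆ A ∪ Set.range v) :
    f.filter (· ∈ A) + (Finsupp.equivFunOnFinite.symm fun i => f (v i)).mapDomain v = f := by
  ext α
  rw [Finsupp.add_apply]
  by_cases hr : α ∈ Set.range v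
  · obtain ⟨i, rfl⟩ := hr
    rw [Finsupp.filter_apply_neg _ _ (hd i), Finsupp.mapDomain_apply hv]
    simp
  · rw [Finsupp.mapDomain_of_notMem_range _ _ hr, add_zero]
    by_cases hα : α ∈ A
    · exact Finsupp.filter_apply_pos _ _ hα
    · rw [Finsupp.filter_apply_neg _ _ hα]
      exact (Finsupp.notMem_support_iff.mp fun hm => (hf hm).elim hα hr).symm

open Classical in
/-- Partitions of `μ` into parts from `A ∪ range v` are pairs consisting of a part supported on
`A` and the multiplicities of the vectors `v i`. -/
def partitionsUnionRangeEquiv {M ι : Type*} [AddCommGroup M] [Fintype ι] (A : Set M)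
    (v : ι → M) (hv : Function.Injective v) (hd : ∀ i, v i ∉ A) (μ : M) :
    {f : M →₀ ℕ // ↑f.support ⊆ A ∪ Set.range v ∧ (f.sum fun α c => c • α) = μ} ≃
      {p : (M →₀ ℕ) × (ι → ℕ) // ↑p.1.support ⊆ A ∧
        (p.1.sum fun α c => c • α) + ∑ i, p.2 i • v i = μ} where
  toFun f := ⟨(f.1.filter (· ∈ A), fun i => f.1 (v i)), by
    refine ⟨fun α hα => ?_, ?_⟩
    · simp only [Finsupp.support_filter, Finset.coe_filter, Set.mem_ofPred_eq] at hα
      exact hα.2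
    · rw [← sum_add_mapDomain_smul, filter_add_mapDomain_eq hv hd f.1 f.2.1, f.2.2]⟩
  invFun p := ⟨p.1.1 + (Finsupp.equivFunOnFinite.symm p.1.2).mapDomain v, by
    refine ⟨fun α hα => ?_, ?_⟩
    · by_contra hn
      rw [Set.mem_union, not_or] at hn
      refine Finsupp.mem_support_iff.mp hα ?_
      rw [Finsupp.add_apply, Finsupp.mapDomain_of_notMem_range _ _ hn.2,
        Finsupp.notMem_support_iff.mp fun hm => hn.1 (p.2.1 hm), add_zero]
    · rw [sum_add_mapDomain_smul, p.2.2]⟩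
  left_inv f := Subtype.ext (filter_add_mapDomain_eq hv hd f.1 f.2.1)
  right_inv p := by
    obtain ⟨⟨g, c⟩, hg, hs⟩ := p
    refine Subtype.ext (Prod.ext (Finsupp.ext fun α => ?_) (funext fun i => ?_))
    · by_cases hα : α ∈ A
      · have hr : α ∉ Set.range v := by
          rintro ⟨i, rfl⟩
          exact hd i hα
        simp [hα, Finsupp.mapDomain_of_notMem_range _ _ hr]
      · simpa [hα] using (Finsupp.notMem_support_iff.mp fun hm => hα (hg hm)).symm
    · have hgi : g (v i) = 0 := Finsupp.notMem_support_iff.mp fun hm => hd i (hg hm)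
      simp [hgi, Finsupp.mapDomain_apply hv]

theorem sum_two_mul_add_indicator_smul {M ι : Type*} [AddCommGroup M] [Fintype ι]
    [DecidableEq ι] (v : ι → M) (c : ι → ℕ) (S : Finset ι) :
    ∑ i, (2 * c i + if i ∈ S then 1 else 0) • v i =
      ∑ i, c i • (2 • v i) + ∑ i ∈ S, v i := by
  simp only [add_smul, Finset.sum_add_distrib, ite_smul, one_smul, zero_smul,
    Finset.sum_ite_mem, Finset.univ_inter, mul_comm 2, mul_smul]

/-- Splitting multiplicities of the `v i` into their parity and their half. -/
def parityEquiv {M ι : Type*} [AddCommGroup M] [Fintype ι] [DecidableEq ι] (A : Set M)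
    (v : ι → M) (μ : M) :
    (Σ S : Finset ι, {p : (M →₀ ℕ) × (ι → ℕ) // ↑p.1.support ⊆ A ∧
        (p.1.sum fun α c => c • α) + ∑ i, p.2 i • (2 • v i) = μ - ∑ i ∈ S, v i}) ≃
      {p : (M →₀ ℕ) × (ι → ℕ) // ↑p.1.support ⊆ A ∧
        (p.1.sum fun α c => c • α) + ∑ i, p.2 i • v i = μ} := by
  refine Equiv.ofBijective
    (fun q => ⟨(q.2.1.1, fun i => 2 * q.2.1.2 i + if i ∈ q.1 then 1 else 0), q.2.2.1, ?_⟩)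
    ⟨?_, ?_⟩
  · rw [sum_two_mul_add_indicator_smul, ← add_assoc, q.2.2.2, sub_add_cancel]
  · rintro ⟨S, ⟨g, c⟩, h⟩ ⟨T, ⟨g', c'⟩, h'⟩ heq
    simp only [Subtype.mk.injEq, Prod.mk.injEq] at heq
    obtain ⟨rfl, hc⟩ := heq
    have hST : S = T := by
      ext i
      have := congrFun hc i
      grind
    subst hST
    have hcc : c = c' := by
      ext i
      have := congrFun hc i
      grind
    subst hcc
    rfl
  · rintro ⟨⟨g, c⟩, hg, hs⟩
    have hc (i : ι) : (2 * (c i / 2) +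
        if i ∈ Finset.univ.filter (fun i => c i % 2 = 1) then 1 else 0) = c i := by
      simp only [Finset.mem_filter, Finset.mem_univ, true_and]
      grind
    refine ⟨⟨Finset.univ.filter (fun i => c i % 2 = 1), (g, fun i => c i / 2), hg, ?_⟩, ?_⟩
    · rw [eq_sub_iff_add_eq, add_assoc, ← sum_two_mul_add_indicator_smul]
      simpa only [hc] using hs
    · exact Subtype.ext (Prod.ext rfl (funext hc))

/-- The roots `ε_i ± ε_j`, `i < j`, of type `D_n`. -/
def DeltaD (n : ℕ) : Set (Fin n → ℤ) :=
  {α | ∃ i j : Fin n, i < j ∧ (α = eps n i - eps n j ∨ α = eps n i + eps n j)}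

theorem deltaC_eq_union (n : ℕ) : DeltaC n = DeltaD n ∪ Set.range fun i => 2 • eps n i := by
  ext α
  simp [DeltaC, DeltaD, eq_comm]

theorem deltaC'_eq_union (n : ℕ) : DeltaC' n = DeltaD n ∪ Set.range (eps n) := by
  ext α
  simp [DeltaC', DeltaD, eq_comm]

theorem eps_injective (n : ℕ) : Function.Injective (eps n) := fun i j h => by
  by_contra hij
  have := congrFun h i
  simp [eps, hij] at this

theorem two_smul_eps_injective (n : ℕ) : Function.Injective fun i => 2 • eps n i :=
  fun _ _ h => eps_injective n (smul_right_injective _ two_ne_zero h)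

theorem smul_eps_notMem_deltaD (n k : ℕ) (l : Fin n) : k • eps n l ∉ DeltaD n := by
  rintro ⟨i, j, hij, h | h⟩ <;>
  · have hi := congrFun h i
    have hj := congrFun h j
    have hne := hij.ne
    simp only [eps, Pi.smul_apply, Pi.add_apply, Pi.sub_apply, Pi.single_apply] at hi hj
    grind

/-- The height functional `x ↦ ∑ (n - i) x_i`, with `i` counted from `0`. -/
def rootHeight (n : ℕ) : (Fin n → ℤ) →+ ℤ :=
  AddMonoidHom.mk' (fun x => (fun i : Fin n => (n : ℤ) - i) ⬝ᵥ x) (dotProduct_add _)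

theorem rootHeight_eps (n : ℕ) (i : Fin n) : rootHeight n (eps n i) = n - i := by
  simp [rootHeight, eps]

theorem one_le_rootHeight_of_mem_deltaC {n : ℕ} {α : Fin n → ℤ} (hα : α ∈ DeltaC n) :
    1 ≤ rootHeight n α := by
  rcases hα with ⟨i, j, hij, rfl | rfl⟩ | ⟨i, rfl⟩
  · rw [map_sub, rootHeight_eps, rootHeight_eps]
    have := Fin.lt_def.mp hij
    omega
  · rw [map_add, rootHeight_eps, rootHeight_eps]
    have := Fin.lt_def.mp hij
    omega
  · rw [map_nsmul, rootHeight_eps, nsmul_eq_mul]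
    push_cast
    omega

theorem finite_deltaC (n : ℕ) : (DeltaC n).Finite := by
  refine ((Set.finite_range fun p : Fin n × Fin n => eps n p.1 - eps n p.2).union
    (Set.finite_range fun p : Fin n × Fin n => eps n p.1 + eps n p.2)).subset ?_
  rintro α (⟨i, j, -, rfl | rfl⟩ | ⟨i, rfl⟩)
  · exact Or.inl ⟨(i, j), rfl⟩
  · exact Or.inr ⟨(i, j), rfl⟩
  · exact Or.inr ⟨(i, i), (two_nsmul _).symm⟩

/-- for every `μ ∈ ℤ^n`, `p'(μ) = Σ_{S ⊆ {1,…,n}} p(μ − Σ_{i∈S} ε_i)`. -/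
theorem kostant_prime_eq_sum_over_subsets (n : ℕ) (hn : 1 ≤ n) (μ : Fin n → ℤ) :
    kostant n (DeltaC' n) μ =
      ∑ S : Finset (Fin n), kostant n (DeltaC n) (μ - ∑ i ∈ S, eps n i) := by
  have hfin (S : Finset (Fin n)) := finite_partitions_of_height (finite_deltaC n) (rootHeight n)
    (fun _ => one_le_rootHeight_of_mem_deltaC) (μ - ∑ i ∈ S, eps n i)
  unfold kostant
  rw [← Nat.card_sigma]
  simp only [deltaC_eq_union, deltaC'_eq_union]
  refine Nat.card_congr ((partitionsUnionRangeEquiv _ _ (eps_injective n)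
    (fun i => by simpa using smul_eps_notMem_deltaD n 1 i) μ).trans
    ((parityEquiv _ _ μ).symm.trans (Equiv.sigmaCongrRight fun S =>
      (partitionsUnionRangeEquiv _ _ (two_smul_eps_injective n)
        (fun i => smul_eps_notMem_deltaD n 2 i) _).symm)))

end
end

section
/- For all dominant λ, μ ∈ ℤ^n, the alternating sum Σ_{w∈W} sgn(w)·p'(w(μ+ρ) − (λ+ρ)) is a nonnegative integer. (By the paper's Theorem, this integer equals the multiplicity dim Hom_G(V_μ, H^0(Ñ, O_Ñ(λ))) of the irreducible Sp_{2n}(ℂ)-module V_μ in the space of global sections of the line bundle O_Ñ(λ) on the exotic Springer resolution.) -/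
noncomputable section

/-- The Weyl group of type `C_n` (signed permutations): the element determined by a
permutation `σ` and signs `ε` acts on `ℤ^n` by `(w·μ)_i = (±1)_i · μ_{σ⁻¹(i)}`. -/
def wAct (n : ℕ) (σ : Equiv.Perm (Fin n)) (ε : Fin n → Bool) (μ : Fin n → ℤ) :
    Fin n → ℤ :=
  fun i => (if ε i then -1 else 1) * μ (σ⁻¹ i)

/-- `sgn(w) = det(w)` for a signed permutation, i.e. `sign(σ) · Π_i (±1)_i`. -/
def wSgn (n : ℕ) (σ : Equiv.Perm (Fin n)) (ε : Fin n → Bool) : ℤ :=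
  (Equiv.Perm.sign σ : ℤ) * ∏ i : Fin n, (if ε i then (-1 : ℤ) else 1)

/-- `ρ = (n, n−1, …, 1)` (0-indexed: `ρ_i = n − i`). -/
def rho (n : ℕ) : Fin n → ℤ := fun i => (n : ℤ) - (i : ℤ)

/-- A weight `λ ∈ ℤ^n` is dominant if `λ_1 ≥ λ_2 ≥ … ≥ λ_n ≥ 0`. -/
def IsDominant (n : ℕ) (l : Fin n → ℤ) : Prop :=
  (∀ i j : Fin n, i ≤ j → l j ≤ l i) ∧ ∀ i : Fin n, 0 ≤ l i


namespace SymplecticCharacter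

section Bialternant

variable {R : Type*} [CommRing R]

/-- The odd Laurent polynomial `z ^ k - z ^ (-k)`. -/
def oddPart (k : ℕ) (z : Rˣ) : R := (z : R) ^ k - (↑z⁻¹ : R) ^ k

/-- The even Laurent polynomial `z + z⁻¹`. -/
def evenPart (z : Rˣ) : R := (z : R) + (↑z⁻¹ : R)

/-- The combination `oddPart (k + 1) z - x * oddPart k z`. -/
def shiftedOddPart (x : Rˣ) (k : ℕ) (z : Rˣ) : R := oddPart (k + 1) z - x * oddPart k z

lemma oddPart_zero (z : Rˣ) : oddPart 0 z = 0 := by simp [oddPart]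

lemma oddPart_add_two (k : ℕ) (z : Rˣ) :
    oddPart (k + 2) z = evenPart z * oddPart (k + 1) z - oddPart k z := by
  have h : (z : R) * (↑z⁻¹ : R) = 1 := z.mul_inv
  simp only [oddPart, evenPart]
  linear_combination ((↑z⁻¹ : R) ^ k - (z : R) ^ k) * h

lemma shiftedOddPart_self (x : Rˣ) (k : ℕ) :
    shiftedOddPart x k x = (↑x⁻¹ : R) ^ k * ((x : R) - (↑x⁻¹ : R)) := by
  simp only [shiftedOddPart, oddPart]
  ring

lemma shiftedOddPart_succ (x : Rˣ) (k : ℕ) (z : Rˣ) :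
    shiftedOddPart x (k + 1) z =
      (evenPart z - evenPart x) * oddPart (k + 1) z + (↑x⁻¹ : R) * shiftedOddPart x k z := by
  have h : (x : R) * (↑x⁻¹ : R) = 1 := x.mul_inv
  have hx : evenPart x = (x : R) + (↑x⁻¹ : R) := rfl
  simp only [shiftedOddPart, oddPart_add_two, hx]
  linear_combination oddPart k z * h

lemma oddPart_eq_sum_add (x z : Rˣ) {b a : ℕ} (hba : b ≤ a) :
    oddPart a z = ∑ k ∈ Finset.Ico b a, (x : R) ^ (a - 1 - k) * shiftedOddPart x k z +
      (x : R) ^ (a - b) * oddPart b z := by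
  induction a, hba using Nat.le_induction with
  | base => simp
  | succ a hba ih =>
    have h1 : ∑ k ∈ Finset.Ico b a, (x : R) ^ (a + 1 - 1 - k) * shiftedOddPart x k z =
        x * ∑ k ∈ Finset.Ico b a, (x : R) ^ (a - 1 - k) * shiftedOddPart x k z := by
      rw [Finset.mul_sum]
      refine Finset.sum_congr rfl fun k hk => ?_
      rw [Finset.mem_Ico] at hk
      rw [show a + 1 - 1 - k = (a - 1 - k) + 1 by omega, pow_succ]
      ring
    rw [Finset.sum_Ico_succ_top hba, h1, Nat.succ_sub hba, pow_succ,
      show a + 1 - 1 - a = 0 by omega]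
    simp only [shiftedOddPart] at ih ⊢
    linear_combination (x : R) * ih

lemma shiftedOddPart_eq_sum_add (x z : Rˣ) {b a : ℕ} (hba : b ≤ a) :
    shiftedOddPart x a z =
      (evenPart z - evenPart x) * ∑ m ∈ Finset.Ioc b a, (↑x⁻¹ : R) ^ (a - m) * oddPart m z +
      (↑x⁻¹ : R) ^ (a - b) * shiftedOddPart x b z := by
  induction a, hba using Nat.le_induction with
  | base => simp
  | succ a hba ih =>
    have h1 : ∑ m ∈ Finset.Ioc b a, (↑x⁻¹ : R) ^ (a + 1 - m) * oddPart m z =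
        (↑x⁻¹ : R) * ∑ m ∈ Finset.Ioc b a, (↑x⁻¹ : R) ^ (a - m) * oddPart m z := by
      rw [Finset.mul_sum]
      refine Finset.sum_congr rfl fun k hk => ?_
      rw [Finset.mem_Ioc] at hk
      rw [show a + 1 - k = (a - k) + 1 by omega, pow_succ]
      ring
    rw [Finset.sum_Ioc_succ_top hba, h1, Nat.succ_sub hba, pow_succ, shiftedOddPart_succ,
      Nat.sub_self]
    linear_combination (↑x⁻¹ : R) * ih

/-- Expansion of a determinant all of whose columns are linear combinations. -/
lemma det_sum_columns {ι κ : Type*} [Fintype ι] [DecidableEq ι]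
    (I : ι → Finset κ) (w : ι → κ → R) (f : κ → ι → R) :
    (Matrix.of fun i j => ∑ k ∈ I j, w j k * f k i).det =
      ∑ r ∈ Fintype.piFinset I,
        (∏ j, w j (r j)) * (Matrix.of fun i j => f (r j) i).det := by
  simp only [Matrix.det_apply', Matrix.of_apply, Finset.prod_univ_sum, Finset.mul_sum]
  rw [Finset.sum_comm]
  refine Finset.sum_congr rfl fun r _ => Finset.sum_congr rfl fun σ _ => ?_
  rw [Finset.prod_mul_distrib]
  ring

/-- The Weyl denominator of type `C`, in terms of `z i - (z i)⁻¹` and the Vandermonde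
product of the `z i + (z i)⁻¹`. -/
def denominator {n : ℕ} (y : Fin n → Rˣ) : R :=
  (∏ i, ((y i : R) - (↑(y i)⁻¹ : R))) *
    ∏ i, ∏ j ∈ Finset.Ioi i, (evenPart (y j) - evenPart (y i))

lemma denominator_succ {n : ℕ} (y : Fin (n + 1) → Rˣ) :
    denominator y = ((y 0 : R) - (↑(y 0)⁻¹ : R)) *
      (∏ i : Fin n, (evenPart (y i.succ) - evenPart (y 0))) *
        denominator fun i => y i.succ := by
  simp only [denominator, Fin.prod_univ_succ, Fin.prod_Ioi_zero, Fin.prod_Ioi_succ]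
  ring

/-- The determinant `det (z i ^ c j - z i ^ (-c j))` of type `C` is the Weyl denominator times
an element with nonnegative coefficients. -/
theorem exists_det_eq_denominator_mul (P : Subsemiring R) :
    ∀ {n : ℕ} (y : Fin n → Rˣ), (∀ i, (y i : R) ∈ P) → (∀ i, (↑(y i)⁻¹ : R) ∈ P) →
      ∀ c : Fin n → ℕ, StrictMono c → (∀ i, 0 < c i) →
      ∃ g ∈ P, denominator y * g = (Matrix.of fun i j => oddPart (c j) (y i)).det
  | 0, y, _, _, c, _, _ => ⟨1, P.one_mem, by simp [denominator]⟩
  | n + 1, y, hy, hy', c, hc, hc0 => by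
    let b : Fin (n + 1) → ℕ := Fin.cons 0 fun j => c j.castSucc
    have hbc : ∀ j, b j ≤ c j := Fin.cases (Nat.zero_le _) fun j =>
      (hc j.castSucc_lt_succ).le
    have hdet : (Matrix.of fun i j => oddPart (c j) (y i)).det =
        (Matrix.of fun i j => ∑ k ∈ Finset.Ico (b j) (c j),
          (y 0 : R) ^ (c j - 1 - k) * shiftedOddPart (y 0) k (y i)).det := by
      refine Matrix.det_eq_of_forall_col_eq_smul_add_pred
        (fun j => (y 0 : R) ^ (c j.succ - c j.castSucc)) (fun i => ?_) fun i j => ?_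
      · simpa [b, oddPart_zero] using oddPart_eq_sum_add (y 0) (y i) (Nat.zero_le (c 0))
      · simpa [b] using oddPart_eq_sum_add (y 0) (y i) (hbc j.succ)
    rw [hdet, det_sum_columns (fun j => Finset.Ico (b j) (c j))
      (fun j k => (y 0 : R) ^ (c j - 1 - k)) fun k i => shiftedOddPart (y 0) k (y i)]
    let A := P.toAddSubmonoid.map (AddMonoidHom.mulLeft (denominator y))
    suffices h : _ ∈ A from h
    have hA : ∀ p ∈ P, ∀ z ∈ A, p * z ∈ A := by
      rintro p hp _ ⟨g, hg, rfl⟩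
      exact ⟨p * g, P.mul_mem hp hg, by simp; ring⟩
    refine sum_mem fun k hk => hA _ (prod_mem fun j _ => pow_mem (hy 0) _) _ ?_
    have hk' : ∀ j, b j ≤ k j ∧ k j < c j := fun j =>
      Finset.mem_Ico.1 (Fintype.mem_piFinset.1 hk j)
    have hkk : ∀ j : Fin n, k j.castSucc < k j.succ := fun j =>
      (hk' j.castSucc).2.trans_le (by simpa [b] using (hk' j.succ).1)
    have hdet' : (Matrix.of fun i j => shiftedOddPart (y 0) (k j) (y i)).det =
        (Matrix.of fun i => (Fin.cons (shiftedOddPart (y 0) (k 0) (y i)) fun j : Fin n =>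
          (evenPart (y i) - evenPart (y 0)) *
            ∑ m ∈ Finset.Ioc (k j.castSucc) (k j.succ),
              (↑(y 0)⁻¹ : R) ^ (k j.succ - m) * oddPart m (y i) : Fin (n + 1) → R)).det := by
      refine Matrix.det_eq_of_forall_col_eq_smul_add_pred
        (fun j => (↑(y 0)⁻¹ : R) ^ (k j.succ - k j.castSucc)) (fun i => ?_) fun i j => ?_
      · simp
      · simpa using shiftedOddPart_eq_sum_add (y 0) (y i) (hkk j).le
    rw [hdet', Matrix.det_succ_row_zero, Fin.sum_univ_succ]
    simp only [Matrix.of_apply, Fin.cons_zero, Fin.cons_succ, sub_self, zero_mul, mul_zero,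
      Finset.sum_const_zero, add_zero, Fin.val_zero, pow_zero, one_mul, Fin.succAbove_zero]
    have hsub : (Matrix.submatrix (Matrix.of fun i =>
        (Fin.cons (shiftedOddPart (y 0) (k 0) (y i)) fun j : Fin n =>
          (evenPart (y i) - evenPart (y 0)) *
            ∑ m ∈ Finset.Ioc (k j.castSucc) (k j.succ),
              (↑(y 0)⁻¹ : R) ^ (k j.succ - m) * oddPart m (y i) : Fin (n + 1) → R))
          Fin.succ Fin.succ).det =
        (∏ i : Fin n, (evenPart (y i.succ) - evenPart (y 0))) *
          (Matrix.of fun i j : Fin n => ∑ m ∈ Finset.Ioc (k j.castSucc) (k j.succ),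
              (↑(y 0)⁻¹ : R) ^ (k j.succ - m) * oddPart m (y i.succ)).det := by
      rw [← Matrix.det_mul_column]
      congr 1
    rw [hsub, det_sum_columns (fun j : Fin n => Finset.Ioc (k j.castSucc) (k j.succ))
      (fun j m => (↑(y 0)⁻¹ : R) ^ (k j.succ - m)) fun m i => oddPart m (y i.succ),
      Finset.mul_sum, Finset.mul_sum]
    refine sum_mem fun m hm => ?_
    have hm' : ∀ j : Fin n, k j.castSucc < m j ∧ m j ≤ k j.succ := fun j =>
      Finset.mem_Ioc.1 (Fintype.mem_piFinset.1 hm j)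
    have hmono : StrictMono m := by
      cases n with
      | zero => exact fun i => i.elim0
      | succ n =>
        refine Fin.strictMono_iff_lt_succ.2 fun j => (hm' j.castSucc).2.trans_lt ?_
        simpa using (hm' j.succ).1
    obtain ⟨g, hg, hgm⟩ := exists_det_eq_denominator_mul P (fun i => y i.succ)
      (fun i => hy _) (fun i => hy' _) m hmono fun j => (Nat.zero_le _).trans_lt (hm' j).1
    refine ⟨(↑(y 0)⁻¹ : R) ^ k 0 * (∏ j : Fin n, (↑(y 0)⁻¹ : R) ^ (k j.succ - m j)) * g,
      P.mul_mem (P.mul_mem (pow_mem (hy' 0) _) (prod_mem fun j _ => pow_mem (hy' 0) _)) hg, ?_⟩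
    rw [← hgm, shiftedOddPart_self, AddMonoidHom.coe_mulLeft, denominator_succ]
    ring

end Bialternant
section Kostant

variable {n : ℕ}

/-- The finitely supported functions counted by `kostant n S μ`. -/
def partitionSet (S : Set (Fin n → ℤ)) (μ : Fin n → ℤ) : Set ((Fin n → ℤ) →₀ ℕ) :=
  {f | ↑f.support ⊆ S ∧ (f.sum fun α c => c • α) = μ}

lemma kostant_eq_ncard (S : Set (Fin n → ℤ)) (μ : Fin n → ℤ) :
    kostant n S μ = (partitionSet S μ).ncard := rfl

lemma finite_partitionSet (S : Finset (Fin n → ℤ)) (h : (Fin n → ℤ) →+ ℤ)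
    (hS : ∀ α ∈ S, 0 < h α) (μ : Fin n → ℤ) : (partitionSet (S : Set (Fin n → ℤ)) μ).Finite := by
  refine (S.finsupp fun _ => Finset.range ((h μ).toNat + 1)).finite_toSet.subset ?_
  rintro f ⟨hf, hμ⟩
  rw [Finset.coe_subset] at hf
  refine Finset.mem_coe.2 (Finset.mem_finsupp_iff.2 ⟨hf, fun β hβ => ?_⟩)
  have hsum : h μ = ∑ α ∈ S, (f α : ℤ) * h α := by
    rw [← hμ, Finsupp.sum_of_support_subset f hf _ (by simp), map_sum]
    exact Finset.sum_congr rfl fun α _ => by rw [map_nsmul, nsmul_eq_mul]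
  have hle : (f β : ℤ) * h β ≤ h μ := hsum ▸ Finset.single_le_sum
    (f := fun α => (f α : ℤ) * h α) (fun α hα => mul_nonneg (by positivity) (hS α hα).le) hβ
  have hle' : (f β : ℤ) ≤ f β * h β := le_mul_of_one_le_right (by positivity) (hS β hβ)
  rw [Finset.mem_range]
  omega

lemma kostant_empty (μ : Fin n → ℤ) : kostant n ∅ μ = if μ = 0 then 1 else 0 := by
  have h : partitionSet (∅ : Set (Fin n → ℤ)) μ = if μ = 0 then {0} else ∅ := by
    ext f
    split_ifs with hμ
    · simp only [partitionSet, Set.mem_ofPred_eq, Set.subset_empty_iff, Finset.coe_eq_empty,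
        Finsupp.support_eq_empty, Set.mem_singleton_iff, and_iff_left_iff_imp]
      rintro rfl
      simp [hμ]
    · simp only [partitionSet, Set.mem_ofPred_eq, Set.subset_empty_iff, Finset.coe_eq_empty,
        Finsupp.support_eq_empty, Set.mem_empty_iff_false, iff_false, not_and]
      rintro rfl
      simpa using Ne.symm hμ
  rw [kostant_eq_ncard, h]
  split_ifs <;> simp

lemma kostant_insert (S : Finset (Fin n → ℤ)) (β : Fin n → ℤ) (hβS : β ∉ S)
    (h : (Fin n → ℤ) →+ ℤ) (hS : ∀ α ∈ insert β S, 0 < h α) (μ : Fin n → ℤ) :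
    kostant n ↑(insert β S) μ = kostant n ↑S μ + kostant n ↑(insert β S) (μ - β) := by
  have hinj : Function.Injective fun f : (Fin n → ℤ) →₀ ℕ => f + Finsupp.single β 1 :=
    add_left_injective _
  have hunion : partitionSet (↑(insert β S) : Set (Fin n → ℤ)) μ = partitionSet ↑S μ ∪
      (fun f => f + Finsupp.single β 1) '' partitionSet ↑(insert β S) (μ - β) := by
    ext f
    simp only [partitionSet, Set.mem_union, Set.mem_image, Set.mem_ofPred_eq, Finset.coe_subset]
    constructor
    · rintro ⟨hf, hμ⟩
      by_cases hfβ : f β = 0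
      · exact Or.inl ⟨(Finset.subset_insert_iff_of_notMem (by simpa using hfβ)).1 hf, hμ⟩
      · have hle : Finsupp.single β 1 ≤ f := by
          rw [Finsupp.single_le_iff]
          omega
        have hadd : f - Finsupp.single β 1 + Finsupp.single β 1 = f := tsub_add_cancel_of_le hle
        refine Or.inr ⟨f - Finsupp.single β 1, ⟨Finsupp.support_tsub.trans hf, ?_⟩, hadd⟩
        rw [← hμ, eq_sub_iff_add_eq]
        conv_rhs => rw [← hadd]
        rw [Finsupp.sum_add_index' (by simp) (by simp [add_smul])]
        simp
    · rintro (⟨hf, hμ⟩ | ⟨g, ⟨hg, hμ⟩, rfl⟩)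
      · exact ⟨hf.trans (Finset.subset_insert _ _), hμ⟩
      · refine ⟨Finsupp.support_add.trans (Finset.union_subset hg
          (Finsupp.support_single_subset.trans (by simp))), ?_⟩
        rw [Finsupp.sum_add_index' (by simp) (by simp [add_smul]), hμ]
        simp
  have hdisj : Disjoint (partitionSet (S : Set (Fin n → ℤ)) μ)
      ((fun f => f + Finsupp.single β 1) '' partitionSet ↑(insert β S) (μ - β)) := by
    rw [Set.disjoint_right]
    rintro _ ⟨g, -, rfl⟩ ⟨hg, -⟩
    exact hβS (hg (by simp))
  rw [kostant_eq_ncard, kostant_eq_ncard, kostant_eq_ncard, hunion, Set.ncard_union_eq hdisj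
    (finite_partitionSet S h (fun α hα => hS α (Finset.mem_insert_of_mem hα)) μ)
    ((finite_partitionSet _ h hS _).image _), Set.ncard_image_of_injective _ hinj]

/-- The group algebra of `ℤ^n`, that is, Laurent polynomials in `n` variables. -/
abbrev LaurentRing (n : ℕ) : Type := AddMonoidAlgebra ℤ (Fin n → ℤ)

/-- The additive functional on the group algebra of `ℤ^n` sending the monomial of exponent `b`
to `kostant n S (b - l)`. -/
def kostantFunctional (S : Set (Fin n → ℤ)) (l : Fin n → ℤ) :
    LaurentRing n →+ ℤ :=
  (Finsupp.liftAddHom fun b => AddMonoidHom.mulRight (kostant n S (b - l) : ℤ)).comp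
    AddMonoidAlgebra.coeffAddEquiv.toAddMonoidHom

lemma kostantFunctional_single (S : Set (Fin n → ℤ)) (l b : Fin n → ℤ) (c : ℤ) :
    kostantFunctional S l (AddMonoidAlgebra.single b c) = c * kostant n S (b - l) := by
  simp [kostantFunctional]

/-- The functional attached to the Kostant partition function of `S` inverts multiplication by
the product of all `1 - e ^ (-α)` with `α ∈ S`. -/
lemma kostantFunctional_mul_prod (S : Finset (Fin n → ℤ)) (h : (Fin n → ℤ) →+ ℤ)
    (hS : ∀ α ∈ S, 0 < h α) (l : Fin n → ℤ) (x : LaurentRing n) :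
    kostantFunctional ↑S l (x * ∏ α ∈ S, (1 - AddMonoidAlgebra.single (-α) 1)) = x.coeff l := by
  induction S using Finset.induction_on generalizing x with
  | empty =>
    induction x using AddMonoidAlgebra.induction_linear with
    | zero => simp
    | add x y hx hy => simpa [add_mul] using congrArg₂ (· + ·) hx hy
    | single b c =>
      simp [kostantFunctional_single, kostant_empty, Finsupp.single_apply, sub_eq_zero]
  | insert β S hβ ih =>
    rw [← ih (fun α hα => hS α (Finset.mem_insert_of_mem hα)), Finset.prod_insert hβ,
      mul_left_comm, mul_comm]
    generalize x * ∏ α ∈ S, (1 - AddMonoidAlgebra.single (-α) 1) = z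
    induction z using AddMonoidAlgebra.induction_linear with
    | zero => simp
    | add x y hx hy => simpa [add_mul] using congrArg₂ (· + ·) hx hy
    | single b c =>
      rw [mul_sub, mul_one, AddMonoidAlgebra.single_mul_single, map_sub,
        kostantFunctional_single, kostantFunctional_single, kostantFunctional_single,
        kostant_insert S β hβ h hS, show b + -β - l = b - l - β by abel]
      push_cast
      ring

end Kostant

section Roots

variable {n : ℕ}

/-- The pairs `i < j`. -/
def orderedPairs (n : ℕ) : Finset (Fin n × Fin n) := Finset.univ.filter fun p => p.1 < p.2

/-- The elements of `DeltaC' n` as a finite set. -/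
def rootFinset (n : ℕ) : Finset (Fin n → ℤ) :=
  ((orderedPairs n).image (fun p => eps n p.1 - eps n p.2) ∪
    (orderedPairs n).image (fun p => eps n p.1 + eps n p.2)) ∪ Finset.univ.image (eps n)

lemma coe_rootFinset (n : ℕ) : (rootFinset n : Set (Fin n → ℤ)) = DeltaC' n := by
  ext α
  simp only [rootFinset, orderedPairs, DeltaC', Finset.coe_union, Finset.coe_image,
    Finset.coe_filter, Finset.mem_univ, true_and, Finset.coe_univ, Set.image_univ, Set.mem_union,
    Set.mem_image, Set.mem_ofPred_eq, Prod.exists, Set.mem_range]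
  grind

/-- Pairing with `rho`. -/
def height (n : ℕ) : (Fin n → ℤ) →+ ℤ where
  toFun v := rho n ⬝ᵥ v
  map_zero' := dotProduct_zero _
  map_add' := dotProduct_add _

lemma height_eps (i : Fin n) : height n (eps n i) = n - i := by
  simp [height, eps, rho]

lemma height_pos : ∀ α ∈ rootFinset n, 0 < height n α := by
  intro α hα
  rw [← Finset.mem_coe, coe_rootFinset] at hα
  rcases hα with ⟨i, j, hij, rfl | rfl⟩ | ⟨i, rfl⟩
  · rw [map_sub, height_eps, height_eps]
    have := Fin.lt_def.1 hij
    omega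
  · rw [map_add, height_eps, height_eps]
    omega
  · rw [height_eps]
    omega

lemma eps_sub_injOn :
    Set.InjOn (fun p : Fin n × Fin n => eps n p.1 - eps n p.2) (orderedPairs n) := by
  rintro ⟨i, j⟩ hij ⟨k, l⟩ hkl h
  simp only [orderedPairs, Finset.coe_filter, Finset.mem_univ, true_and,
    Set.mem_ofPred_eq] at hij hkl
  have hi := congrFun h i
  have hj := congrFun h j
  simp only [eps, Pi.sub_apply, Pi.single_apply] at hi hj
  grind

lemma eps_add_injOn :
    Set.InjOn (fun p : Fin n × Fin n => eps n p.1 + eps n p.2) (orderedPairs n) := by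
  rintro ⟨i, j⟩ hij ⟨k, l⟩ hkl h
  simp only [orderedPairs, Finset.coe_filter, Finset.mem_univ, true_and,
    Set.mem_ofPred_eq] at hij hkl
  have hi := congrFun h i
  have hj := congrFun h j
  simp only [eps, Pi.add_apply, Pi.single_apply] at hi hj
  grind

lemma eps_injective : Function.Injective (eps n) := fun i j h => by
  have hi := congrFun h i
  simp only [eps, Pi.single_apply] at hi
  grind

lemma sum_eps (i : Fin n) : ∑ k, eps n i k = 1 := by simp [eps]

lemma prod_rootFinset {M : Type*} [CommMonoid M] (f : (Fin n → ℤ) → M) :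
    ∏ α ∈ rootFinset n, f α = (∏ p ∈ orderedPairs n, f (eps n p.1 - eps n p.2)) *
      (∏ p ∈ orderedPairs n, f (eps n p.1 + eps n p.2)) * ∏ i, f (eps n i) := by
  have h1 : ∀ p : Fin n × Fin n, ∑ k, (eps n p.1 - eps n p.2) k = 0 := fun p => by
    simp [Finset.sum_sub_distrib, sum_eps]
  have h2 : ∀ p : Fin n × Fin n, ∑ k, (eps n p.1 + eps n p.2) k = 2 := fun p => by
    simp [Finset.sum_add_distrib, sum_eps]
  rw [rootFinset, Finset.prod_union, Finset.prod_union, Finset.prod_image eps_sub_injOn,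
    Finset.prod_image eps_add_injOn, Finset.prod_image eps_injective.injOn]
  · rw [Finset.disjoint_left]
    simp only [Finset.mem_image]
    rintro _ ⟨p, -, rfl⟩ ⟨q, -, hq⟩
    have := h1 p
    rw [← hq, h2] at this
    omega
  · rw [Finset.disjoint_left]
    simp only [Finset.mem_union, Finset.mem_image]
    rintro _ (⟨p, -, rfl⟩ | ⟨p, -, rfl⟩) ⟨i, -, hi⟩
    · have := h1 p
      rw [← hi, sum_eps] at this
      omega
    · have := h2 p
      rw [← hi, sum_eps] at this
      omega

end Roots

section Monomials

variable {n : ℕ}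

/-- The coordinate monomial `e ^ ε_i`, as a unit of the group algebra of `ℤ^n`. -/
def coordUnit (n : ℕ) (i : Fin n) : (LaurentRing n)ˣ where
  val := AddMonoidAlgebra.single (eps n i) 1
  inv := AddMonoidAlgebra.single (-eps n i) 1
  val_inv := by simp [AddMonoidAlgebra.single_mul_single, AddMonoidAlgebra.one_def]
  inv_val := by simp [AddMonoidAlgebra.single_mul_single, AddMonoidAlgebra.one_def]

lemma coe_coordUnit (i : Fin n) :
    (coordUnit n i : LaurentRing n) = AddMonoidAlgebra.single (eps n i) 1 := rfl

lemma coe_coordUnit_inv (i : Fin n) :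
    (↑(coordUnit n i)⁻¹ : LaurentRing n) =
      AddMonoidAlgebra.single (-eps n i) 1 := rfl

/-- The elements of the group algebra with nonnegative coefficients. -/
def nonnegSubsemiring (n : ℕ) : Subsemiring (LaurentRing n) where
  carrier := {x | ∀ b, 0 ≤ x.coeff b}
  zero_mem' _ := le_rfl
  add_mem' hx hy b := add_nonneg (hx b) (hy b)
  one_mem' b := by
    classical
    rw [AddMonoidAlgebra.one_def, AddMonoidAlgebra.coeff_single, Finsupp.single_apply]
    split_ifs <;> simp
  mul_mem' {x y} hx hy b := by
    classical
    rw [AddMonoidAlgebra.coeff_mul]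
    refine Finset.sum_nonneg fun i _ => Finset.sum_nonneg fun j _ => ?_
    dsimp only
    split_ifs
    exacts [mul_nonneg (hx i) (hy j), le_rfl]

lemma single_mem_nonnegSubsemiring (b : Fin n → ℤ) :
    AddMonoidAlgebra.single b 1 ∈ nonnegSubsemiring n := fun c => by
  classical
  rw [AddMonoidAlgebra.coeff_single, Finsupp.single_apply]
  split_ifs <;> simp

lemma oddPart_coordUnit (k : ℤ) (hk : 0 ≤ k) (i : Fin n) :
    oddPart k.toNat (coordUnit n i) = ∑ s : Bool,
      AddMonoidAlgebra.single (((if s then -1 else 1) * k) • eps n i) (if s then -1 else 1) := by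
  lift k to ℕ using hk
  simp only [oddPart, coe_coordUnit, coe_coordUnit_inv, AddMonoidAlgebra.single_pow, one_pow,
    Int.toNat_natCast, Fintype.sum_bool, if_true, Bool.false_eq_true, if_false, one_mul, neg_mul,
    neg_smul, natCast_zsmul, smul_neg]
  rw [← neg_add_eq_sub, ← AddMonoidAlgebra.single_neg]

/-- The type `C` determinant in the coordinate monomials is the alternating sum over the
Weyl group. -/
lemma det_oddPart_coordUnit (a : Fin n → ℤ) (ha : ∀ i, 0 ≤ a i) :
    (Matrix.of fun i j => oddPart (a j).toNat (coordUnit n i)).det =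
      ∑ σ : Equiv.Perm (Fin n), ∑ ε : Fin n → Bool,
        AddMonoidAlgebra.single (wAct n σ ε a) (wSgn n σ ε) := by
  rw [Matrix.det_apply']
  refine Finset.sum_congr rfl fun σ _ => ?_
  have hσ : ∏ i, Matrix.of (fun i j => oddPart (a j).toNat (coordUnit n i)) (σ i) i =
      ∏ i, oddPart (a (σ⁻¹ i)).toNat (coordUnit n i) := by
    rw [← Equiv.prod_comp σ fun i => oddPart (a (σ⁻¹ i)).toNat (coordUnit n i)]
    simp
  rw [hσ]
  simp only [oddPart_coordUnit _ (ha _), Finset.prod_univ_sum, Fintype.piFinset_univ,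
    Finset.mul_sum, AddMonoidAlgebra.prod_single]
  refine Finset.sum_congr rfl fun ε _ => ?_
  rw [← zsmul_eq_mul, AddMonoidAlgebra.smul_single]
  congr 1
  ext i
  simp only [wAct, eps, Finset.sum_apply, Pi.smul_apply, smul_eq_mul, Pi.single_apply, mul_ite,
    mul_one, mul_zero, Finset.sum_ite_eq, Finset.mem_univ, if_true]

lemma coordUnit_sub_inv (i : Fin n) :
    (coordUnit n i : LaurentRing n) - (↑(coordUnit n i)⁻¹ : LaurentRing n) =
      (coordUnit n i : LaurentRing n) * (1 + (↑(coordUnit n i)⁻¹ : LaurentRing n)) *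
        ((1 : LaurentRing n) - AddMonoidAlgebra.single (-eps n i) 1) := by
  rw [← coe_coordUnit_inv]
  linear_combination (↑(coordUnit n i)⁻¹ : LaurentRing n) *
    (coordUnit n i).mul_inv

lemma evenPart_coordUnit_sub (i j : Fin n) :
    evenPart (coordUnit n i) - evenPart (coordUnit n j) =
      (coordUnit n i : LaurentRing n) *
        (((1 : LaurentRing n) - AddMonoidAlgebra.single (-(eps n i - eps n j)) 1) *
        ((1 : LaurentRing n) - AddMonoidAlgebra.single (-(eps n i + eps n j)) 1)) := by
  have h1 : (AddMonoidAlgebra.single (-(eps n i - eps n j)) 1 : LaurentRing n) =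
      (↑(coordUnit n i)⁻¹ : LaurentRing n) * (coordUnit n j : LaurentRing n) := by
    rw [coe_coordUnit, coe_coordUnit_inv, AddMonoidAlgebra.single_mul_single, mul_one]
    congr 1
    abel
  have h2 : (AddMonoidAlgebra.single (-(eps n i + eps n j)) 1 : LaurentRing n) =
      (↑(coordUnit n i)⁻¹ : LaurentRing n) * (↑(coordUnit n j)⁻¹ : LaurentRing n) := by
    rw [coe_coordUnit_inv, coe_coordUnit_inv, AddMonoidAlgebra.single_mul_single, mul_one]
    congr 1
    abel
  rw [h1, h2, evenPart, evenPart]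
  have hi := (coordUnit n i).mul_inv
  have hj := (coordUnit n j).mul_inv
  generalize (coordUnit n i : LaurentRing n) = x at *
  generalize (↑(coordUnit n i)⁻¹ : LaurentRing n) = x' at *
  generalize (coordUnit n j : LaurentRing n) = y at *
  generalize (↑(coordUnit n j)⁻¹ : LaurentRing n) = y' at *
  linear_combination (y + y' - x' * y * y') * hi - x' * hj

lemma denominator_coordUnit_rev :
    denominator (fun i => coordUnit n i.rev) =
      ((∏ i, (coordUnit n i : LaurentRing n) * (1 + (↑(coordUnit n i)⁻¹ : LaurentRing n))) *
        ∏ p ∈ orderedPairs n, (coordUnit n p.1 : LaurentRing n)) *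
      ∏ α ∈ rootFinset n, ((1 : LaurentRing n) - AddMonoidAlgebra.single (-α) 1) := by
  have h1 := Equiv.prod_comp Fin.revPerm fun i : Fin n =>
    (coordUnit n i : LaurentRing n) - (↑(coordUnit n i)⁻¹ : LaurentRing n)
  have h2 : ∏ i : Fin n, ∏ j ∈ Finset.Ioi i,
      (evenPart (coordUnit n j.rev) - evenPart (coordUnit n i.rev)) =
      ∏ p ∈ orderedPairs n, (evenPart (coordUnit n p.1) - evenPart (coordUnit n p.2)) := by
    rw [Finset.prod_sigma']
    refine Finset.prod_bij' (fun p _ => (p.2.rev, p.1.rev)) (fun p _ => ⟨p.2.rev, p.1.rev⟩)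
      ?_ ?_ ?_ ?_ ?_ <;> simp [orderedPairs]
  simp only [Fin.revPerm_apply] at h1
  rw [denominator, h1, h2, prod_rootFinset]
  simp only [coordUnit_sub_inv, evenPart_coordUnit_sub, Finset.prod_mul_distrib]
  ring

end Monomials

end SymplecticCharacter

open SymplecticCharacter

/-- for dominant `λ, μ ∈ ℤ^n`, the alternating sum
`Σ_{w ∈ W} sgn(w) · p'(w(μ+ρ) − (λ+ρ))` is a nonnegative integer
(it equals `dim Hom_G(V_μ, H⁰(Ñ, O_Ñ(λ)))`). -/
theorem alternating_sum_nonneg (n : ℕ) (hn : 1 ≤ n) (lam mu : Fin n → ℤ)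
    (hlam : IsDominant n lam) (hmu : IsDominant n mu) :
    0 ≤ ∑ σ : Equiv.Perm (Fin n), ∑ ε : Fin n → Bool,
      wSgn n σ ε *
        (kostant n (DeltaC' n) (wAct n σ ε (mu + rho n) - (lam + rho n)) : ℤ) := by
  set a := mu + rho n with ha
  have hanti : StrictAnti a := fun i j hij => by
    have h1 := hmu.1 i j hij.le
    have h2 := Fin.lt_def.1 hij
    simp only [ha, Pi.add_apply, rho]
    omega
  have hpos : ∀ i, 0 < a i := fun i => by
    have h1 := hmu.2 i
    have h2 := i.isLt
    simp only [ha, Pi.add_apply, rho]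
    omega
  have hsum : ∑ σ : Equiv.Perm (Fin n), ∑ ε : Fin n → Bool, wSgn n σ ε *
      (kostant n (DeltaC' n) (wAct n σ ε a - (lam + rho n)) : ℤ) =
      kostantFunctional (DeltaC' n) (lam + rho n)
        (Matrix.of fun i j => oddPart (a j).toNat (coordUnit n i)).det := by
    simp only [det_oddPart_coordUnit a fun i => (hpos i).le, map_sum, kostantFunctional_single]
  have hmem : ∀ i, (coordUnit n i : LaurentRing n) ∈ nonnegSubsemiring n :=
    fun i => single_mem_nonnegSubsemiring _
  have hmem' : ∀ i, (↑(coordUnit n i)⁻¹ : LaurentRing n) ∈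
      nonnegSubsemiring n := fun i => single_mem_nonnegSubsemiring _
  obtain ⟨g, hg, hdet⟩ := exists_det_eq_denominator_mul (nonnegSubsemiring n)
    (fun i => coordUnit n i.rev) (fun i => hmem _) (fun i => hmem' _)
    (fun i => (a i.rev).toNat)
    (fun i j hij => (Int.toNat_lt_toNat (hpos _)).2 (hanti (Fin.rev_lt_rev.2 hij)))
    fun i => Int.lt_toNat.2 (hpos _)
  have hrev : (Matrix.of fun i j : Fin n => oddPart (a j.rev).toNat (coordUnit n i.rev)).det =
      (Matrix.of fun i j => oddPart (a j).toNat (coordUnit n i)).det :=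
    Matrix.det_submatrix_equiv_self Fin.revPerm
      (Matrix.of fun i j => oddPart (a j).toNat (coordUnit n i))
  rw [hsum, ← hrev, ← hdet, denominator_coordUnit_rev, mul_right_comm, ← coe_rootFinset,
    kostantFunctional_mul_prod _ (height n) height_pos]
  refine (nonnegSubsemiring n).mul_mem (mul_mem (prod_mem fun i _ => mul_mem (hmem i)
    (add_mem (one_mem _) (hmem' i))) (prod_mem fun p _ => hmem p.1)) hg _

end
end

section
/- Let λ, μ ∈ ℤ^n be dominant weights. If λ does not lie in conv(μ), the convex hull in ℝ^n of the W-orbit of μ, then Σ_{w∈W} sgn(w)·p'(w(μ+ρ) − (λ+ρ)) = 0. -/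
noncomputable section

/-- The convex hull in `ℝ^n` of the `W`-orbit of `μ ∈ ℤ^n`. -/
def convW (n : ℕ) (μ : Fin n → ℤ) : Set (Fin n → ℝ) :=
  convexHull ℝ {v : Fin n → ℝ | ∃ (σ : Equiv.Perm (Fin n)) (ε : Fin n → Bool),
    v = fun i => ((wAct n σ ε μ) i : ℝ)}

/-- Dominant pairings only decrease when one argument is moved by a signed permutation. -/
theorem sum_mul_wAct_le (n : ℕ) {c : Fin n → ℝ} (hc : Antitone c) (hc0 : ∀ i, 0 ≤ c i)
    {ν : Fin n → ℤ} (hν : IsDominant n ν) (σ : Equiv.Perm (Fin n)) (ε : Fin n → Bool) :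
    ∑ i, c i * (wAct n σ ε ν i : ℝ) ≤ ∑ i, c i * (ν i : ℝ) := by
  have hmv : Monovary c (fun i => (ν i : ℝ)) :=
    hc.monovary fun i j hij => Int.cast_le.mpr (hν.1 i j hij)
  refine le_trans (Finset.sum_le_sum fun i _ => ?_) (hmv.sum_mul_comp_perm_le_sum_mul (σ := σ⁻¹))
  have h0 : (0 : ℝ) ≤ ν (σ⁻¹ i) := Int.cast_nonneg (hν.2 _)
  refine mul_le_mul_of_nonneg_left ?_ (hc0 i)
  unfold wAct
  split_ifs <;> push_cast <;> linarith

/-- A dominant functional is nonnegative on the roots of `DeltaC'`. -/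
theorem sum_mul_nonneg_of_mem_DeltaC' (n : ℕ) {c : Fin n → ℝ} (hc : Antitone c)
    (hc0 : ∀ i, 0 ≤ c i) {α : Fin n → ℤ} (hα : α ∈ DeltaC' n) :
    0 ≤ ∑ i, c i * (α i : ℝ) := by
  have heps (j : Fin n) : ∑ i, c i * (eps n j i : ℝ) = c j := by
    simp [eps, Pi.single_apply]
  rcases hα with ⟨i, j, hij, rfl | rfl⟩ | ⟨i, rfl⟩
  · simpa [mul_sub, Finset.sum_sub_distrib, heps] using hc hij.le
  · simpa [mul_add, Finset.sum_add_distrib, heps] using add_nonneg (hc0 i) (hc0 j)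
  · simpa [heps] using hc0 i

/-- The partition function of `DeltaC'` vanishes where some dominant functional is negative. -/
theorem kostant_DeltaC'_eq_zero (n : ℕ) {c : Fin n → ℝ} (hc : Antitone c)
    (hc0 : ∀ i, 0 ≤ c i) {ν : Fin n → ℤ} (hν : ∑ i, c i * (ν i : ℝ) < 0) :
    kostant n (DeltaC' n) ν = 0 := by
  have : IsEmpty {f : (Fin n → ℤ) →₀ ℕ //
      ↑f.support ⊆ DeltaC' n ∧ (f.sum fun α c => c • α) = ν} := by
    refine ⟨fun ⟨f, hf, hsum⟩ => hν.not_ge ?_⟩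
    have hrw : ∑ i, c i * (ν i : ℝ) =
        ∑ α ∈ f.support, (f α : ℝ) * ∑ i, c i * (α i : ℝ) := by
      simp only [← hsum, Finsupp.sum, Finset.sum_apply, Int.cast_sum, Finset.mul_sum]
      rw [Finset.sum_comm]
      exact Finset.sum_congr rfl fun _ _ => Finset.sum_congr rfl fun _ _ => by
        rw [Pi.smul_apply, nsmul_eq_mul, Int.cast_mul, Int.cast_natCast]
        ring
    rw [hrw]
    exact Finset.sum_nonneg fun α hα =>
      mul_nonneg (Nat.cast_nonneg _) (sum_mul_nonneg_of_mem_DeltaC' n hc hc0 (hf hα))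
  exact Nat.card_of_isEmpty

/-- A dominant weight outside `convW n μ` is separated from `μ` by a dominant functional. -/
theorem exists_antitone_sum_lt_of_notMem_convW (n : ℕ) {lam mu : Fin n → ℤ}
    (hlam : IsDominant n lam) (hconv : (fun i => (lam i : ℝ)) ∉ convW n mu) :
    ∃ c : Fin n → ℝ, Antitone c ∧ (∀ i, 0 ≤ c i) ∧
      ∑ i, c i * (mu i : ℝ) < ∑ i, c i * (lam i : ℝ) := by
  have hfin : {v : Fin n → ℝ | ∃ (σ : Equiv.Perm (Fin n)) (ε : Fin n → Bool),
      v = fun i => ((wAct n σ ε mu) i : ℝ)}.Finite := by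
    refine (Set.finite_range fun p : Equiv.Perm (Fin n) × (Fin n → Bool) =>
      fun i => ((wAct n p.1 p.2 mu) i : ℝ)).subset ?_
    rintro v ⟨σ, ε, rfl⟩
    exact ⟨(σ, ε), rfl⟩
  obtain ⟨f, u, hfu, hu⟩ := geometric_hahn_banach_closed_point (convex_convexHull ℝ _)
    (hfin.isClosed_convexHull (𝕜 := ℝ)) hconv
  set a : Fin n → ℝ := fun i => f (Pi.single i 1) with ha
  have hf (x : Fin n → ℝ) : f x = ∑ i, a i * x i := by
    have h := LinearMap.pi_apply_eq_sum_univ f.toLinearMap x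
    simp only [ContinuousLinearMap.coe_coe, smul_eq_mul] at h
    rw [h]
    refine Finset.sum_congr rfl fun i _ => ?_
    rw [mul_comm, ha]
    congr 2
    ext j
    simp [Pi.single_apply, eq_comm]
  set σ := Tuple.sort fun i => -|a i|
  have hanti : Antitone fun i => |a (σ i)| := fun i j hij =>
    neg_le_neg_iff.mp (Tuple.monotone_sort (fun i => -|a i|) hij)
  refine ⟨fun i => |a (σ i)|, hanti, fun i => abs_nonneg _, ?_⟩
  have hmu : ∑ i, |a (σ i)| * (mu i : ℝ) < u := by
    refine lt_of_eq_of_lt ?_ (hfu _ (subset_convexHull ℝ _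
      ⟨σ, fun j => decide (a j < 0), rfl⟩))
    rw [hf, ← Equiv.sum_comp σ fun i => a i * _]
    refine Finset.sum_congr rfl fun i _ => ?_
    by_cases h : a (σ i) < 0
    · simp [wAct, h, abs_of_neg h]
    · simp [wAct, h, abs_of_nonneg (not_lt.mp h)]
  have hlam' : f (fun i => (lam i : ℝ)) ≤ ∑ i, |a (σ i)| * (lam i : ℝ) := by
    have hmv : Monovary (fun i => |a (σ i)|) (fun i => (lam i : ℝ)) :=
      hanti.monovary fun i j hij => Int.cast_le.mpr (hlam.1 i j hij)
    refine le_trans ?_ (hmv.sum_comp_perm_mul_le_sum_mul (σ := σ⁻¹))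
    rw [hf]
    refine Finset.sum_le_sum fun i _ => ?_
    simpa using mul_le_mul_of_nonneg_right (le_abs_self (a i))
      (Int.cast_nonneg (R := ℝ) (hlam.2 i))
  linarith

/-- Adding `rho n` preserves dominance. -/
theorem IsDominant.add_rho {n : ℕ} {μ : Fin n → ℤ} (hμ : IsDominant n μ) :
    IsDominant n (μ + rho n) := by
  refine ⟨fun i j hij => ?_, fun i => ?_⟩
  · have h1 := hμ.1 i j hij
    have h2 : (i : ℕ) ≤ j := hij
    simp only [Pi.add_apply, rho]
    omega
  · have h1 := hμ.2 i
    have h2 := i.isLt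
    simp only [Pi.add_apply, rho]
    omega

/-- for dominant `λ, μ ∈ ℤ^n`, if `λ` does not lie in the convex hull of the
`W`-orbit of `μ`, then `Σ_{w ∈ W} sgn(w) · p'(w(μ+ρ) − (λ+ρ)) = 0`. -/
theorem alternating_sum_eq_zero_of_not_mem_conv (n : ℕ) (hn : 1 ≤ n)
    (lam mu : Fin n → ℤ) (hlam : IsDominant n lam) (hmu : IsDominant n mu)
    (hconv : (fun i => (lam i : ℝ)) ∉ convW n mu) :
    (∑ σ : Equiv.Perm (Fin n), ∑ ε : Fin n → Bool,
      wSgn n σ ε *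
        (kostant n (DeltaC' n) (wAct n σ ε (mu + rho n) - (lam + rho n)) : ℤ)) = 0 := by
  obtain ⟨c, hc, hc0, hlt⟩ := exists_antitone_sum_lt_of_notMem_convW n hlam hconv
  refine Finset.sum_eq_zero fun σ _ => Finset.sum_eq_zero fun ε _ => ?_
  rw [kostant_DeltaC'_eq_zero n hc hc0, Nat.cast_zero, mul_zero]
  have h := sum_mul_wAct_le n hc hc0 hmu.add_rho σ ε
  simp only [Pi.add_apply, Pi.sub_apply, Int.cast_add, Int.cast_sub, mul_add, mul_sub,
    Finset.sum_add_distrib, Finset.sum_sub_distrib] at h ⊢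
  linarith

end
end
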